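/- Let L be the empty first-order language (pure equality) and let T be the theory of infinite sets, i.e., the L-theory axiomatized by the sentences asserting the existence of at least n distinct elements for each n ∈ ℕ. Then T_aut (the theory of an infinite set equipped with a bijection σ) has a model completion T^mc_aut, and every completion of T^mc_aut is stable. -/

import Mathlib

namespace FirstOrder

open Language Structure

universe u v w

namespace ShelahE34

/-- The index type for the function symbols of the language consisting of a single
unary function symbol `σ`. -/
inductive SigmaFunc : ℕ → Type
  | sigma : SigmaFunc 1

/-- The language consisting of a single unary function symbol `σ`. -/
def sigmaLang : Language.{0, 0} :=
  ⟨SigmaFunc, fun _ => Empty⟩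

/-- `L⁺`: the language `L` expanded by one new unary function symbol `σ`. -/
abbrev LPlus (L : Language.{u, v}) : Language :=
  L.sum sigmaLang

/-- The new unary function symbol `σ` of `L⁺`. -/
def sigmaSymb (L : Language.{u, v}) : (LPlus L).Functions 1 :=
  Sum.inr SigmaFunc.sigma

/-- Application of the symbol `σ` to a term of `L⁺`. -/
def sigmaTerm {L : Language.{u, v}} {α : Type w} (t : (LPlus L).Term α) : (LPlus L).Term α :=
  Functions.apply₁ (sigmaSymb L) t

/-- The interpretation of the symbol `σ` in an `L⁺`-structure, as a function. -/
def sigmaMap (L : Language.{u, v}) (N : Type w) [(LPlus L).Structure N] : N → N :=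
  fun x => funMap (sigmaSymb L) ![x]

/-- The sentence `(∀x)(∀y)(σ(x) = σ(y) → x = y)`. -/
def sigmaInj (L : Language.{u, v}) : (LPlus L).Sentence :=
  ∀' ∀' ((sigmaTerm (&0) =' sigmaTerm (&1)) ⟹ ((&0) =' (&1)))

/-- The sentence `(∀y)(∃x)(σ(x) = y)`. -/
def sigmaSurj (L : Language.{u, v}) : (LPlus L).Sentence :=
  ∀' ∃' (sigmaTerm (&1) =' (&0))

/-- The sentence `(∀x̄)(F(σ(x̄)) = σ(F(x̄)))` for a function symbol `F` of `L`. -/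
def funCommSentence (L : Language.{u, v}) {n : ℕ} (F : L.Functions n) : (LPlus L).Sentence :=
  BoundedFormula.alls
    (sigmaTerm (Term.func (Sum.inl F : (LPlus L).Functions n) fun i => Term.var (Sum.inr i)) ='
      Term.func (Sum.inl F : (LPlus L).Functions n) fun i => sigmaTerm (Term.var (Sum.inr i)))

/-- The sentence `(∀x̄)(R(x̄) ↔ R(σ(x̄)))` for a relation symbol `R` of `L`. -/
def relPresSentence (L : Language.{u, v}) {n : ℕ} (R : L.Relations n) : (LPlus L).Sentence :=
  BoundedFormula.alls
    ((Relations.boundedFormula (Sum.inl R : (LPlus L).Relations n)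
        fun i => Term.var (Sum.inr i)) ⇔
      Relations.boundedFormula (Sum.inl R : (LPlus L).Relations n)
        fun i => sigmaTerm (Term.var (Sum.inr i)))

/-- `T_aut`: the `L⁺`-theory consisting of `T` together with the sentences asserting that `σ`
is an automorphism. -/
def Taut {L : Language.{u, v}} (T : L.Theory) : (LPlus L).Theory :=
  (LHom.sumInl : L →ᴸ LPlus L).onTheory T ∪ {sigmaInj L, sigmaSurj L} ∪
    {φ | ∃ (n : ℕ) (F : L.Functions n), φ = funCommSentence L F} ∪
    {φ | ∃ (n : ℕ) (R : L.Relations n), φ = relPresSentence L R}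

/-- A theory is complete and consistent if it is satisfiable and semantically decides every
sentence. -/
def SemComplete {L' : Language.{u, v}} (U : L'.Theory) : Prop :=
  U.IsSatisfiable ∧ ∀ φ : L'.Sentence, U ⊨ᵇ φ ∨ U ⊨ᵇ ∼φ

/-- A completion of a theory `S`: a complete consistent theory in the same language
containing `S`. -/
def IsCompletionOf {L' : Language.{u, v}} (S U : L'.Theory) : Prop :=
  S ⊆ U ∧ SemComplete U

/-- The atomic diagram of a structure `M`: all atomic and negated atomic sentences with
constants from `M` that hold in `M`. -/
def atomicDiagram (L' : Language.{u, v}) (M : Type w) [L'.Structure M] : (L'[[M]]).Theory :=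
  {φ | (φ.IsAtomic ∨ ∃ ψ : (L'[[M]]).Sentence, ψ.IsAtomic ∧ φ = ∼ψ) ∧ M ⊨ φ}

/-- `Tstar` is a model completion of `S`: it contains `S`, every model of `S` embeds into a
model of `Tstar`, and for every model `M` of `S`, `Tstar` together with the atomic diagram of
`M` is a complete consistent theory. -/
def IsModelCompletion.{u', v', w'} {L' : Language.{u', v'}} (S Tstar : L'.Theory) : Prop :=
  S ⊆ Tstar ∧
    (∀ M : Theory.ModelType.{u', v', w'} S, ∃ N : Theory.ModelType.{u', v', w'} Tstar,
      Nonempty (M ↪[L'] N)) ∧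
    ∀ M : Theory.ModelType.{u', v', w'} S,
      SemComplete ((L'.lhomWithConstants M).onTheory Tstar ∪ atomicDiagram L' M)

/-- A formula has the order property with respect to a theory `S` if in some model of `S`
there are tuples `(ā_i)` and `(b̄_j)` such that `φ(ā_i, b̄_j)` holds iff `i < j`. -/
def HasOrderProperty.{u', v', w'} {L' : Language.{u', v'}} (S : L'.Theory) : Prop :=
  ∃ (nx ny : ℕ) (φ : L'.Formula (Fin nx ⊕ Fin ny)) (N : Theory.ModelType.{u', v', w'} S)
    (a : ℕ → Fin nx → N) (b : ℕ → Fin ny → N),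
    ∀ i j : ℕ, φ.Realize (Sum.elim (a i) (b j)) ↔ i < j

/-- A theory is stable if no formula has the order property with respect to it. -/
def IsStableTheory.{u', v', w'} {L' : Language.{u', v'}} (S : L'.Theory) : Prop :=
  ¬ HasOrderProperty.{u', v', w'} S

/-! ### Combinatorial part -/

/-- Two tuples agree on the relations `σ^k x = σ^l y` with `k, l ≤ K`. -/
def Agree {ι : Type*} {N₁ : Type*} {N₂ : Type*} (s₁ : N₁ → N₁) (s₂ : N₂ → N₂)
    (A : Finset ι) (K : ℕ) (a : ι → N₁) (b : ι → N₂) : Prop :=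
  ∀ p ∈ A, ∀ q ∈ A, ∀ k ≤ K, ∀ l ≤ K,
    (s₁^[k] (a p) = s₁^[l] (a q) ↔ s₂^[k] (b p) = s₂^[l] (b q))

/-- A bijection with infinitely many points of each finite period. -/
def GoodMap {N : Type*} (s : N → N) : Prop :=
  Function.Bijective s ∧ ∀ n : ℕ, {x | Function.minimalPeriod s x = n + 1}.Infinite

theorem Agree.symm {ι : Type*} {N₁ : Type*} {N₂ : Type*} {s₁ : N₁ → N₁} {s₂ : N₂ → N₂}
    {A : Finset ι} {K : ℕ} {a : ι → N₁} {b : ι → N₂} (h : Agree s₁ s₂ A K a b) :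
    Agree s₂ s₁ A K b a :=
  fun p hp q hq k hk l hl => (h p hp q hq k hk l hl).symm

theorem Agree.mono {ι : Type*} {N₁ : Type*} {N₂ : Type*} {s₁ : N₁ → N₁} {s₂ : N₂ → N₂}
    {A B : Finset ι} {K K' : ℕ} {a : ι → N₁} {b : ι → N₂} (h : Agree s₁ s₂ A K a b)
    (hB : B ⊆ A) (hK : K' ≤ K) :
    Agree s₁ s₂ B K' a b :=
  fun p hp q hq k hk l hl => h p (hB hp) q (hB hq) k (hk.trans hK) l (hl.trans hK)

theorem iterate_eq_iff_dvd {N : Type*} {s : N → N} (hs : Function.Injective s) (x : N)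
    {m n : ℕ} (h : m ≤ n) :
    s^[m] x = s^[n] x ↔ Function.minimalPeriod s x ∣ n - m := by
  obtain ⟨e, rfl⟩ := Nat.exists_eq_add_of_le h
  rw [Function.iterate_add_apply, (hs.iterate m).eq_iff, Nat.add_sub_cancel_left,
    ← Function.isPeriodicPt_iff_minimalPeriod_dvd]
  exact eq_comm

theorem Agree.extend {ι : Type*} {N₁ : Type*} {N₂ : Type*} {s₁ : N₁ → N₁} {s₂ : N₂ → N₂}
    {A : Finset ι} {K : ℕ} {a : ι → N₁} {b : ι → N₂} (h : Agree s₁ s₂ A (2 * K) a b)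
    (h₁ : GoodMap s₁) (h₂ : GoodMap s₂) (c : N₁) :
    ∃ d : N₂, (∀ p ∈ A, ∀ k ≤ K, ∀ l ≤ K, (s₁^[k] c = s₁^[l] (a p) ↔ s₂^[k] d = s₂^[l] (b p))) ∧
      ∀ k ≤ K, ∀ l ≤ K, (s₁^[k] c = s₁^[l] c ↔ s₂^[k] d = s₂^[l] d) := by
  classical
  have i₁ := h₁.1.1
  have i₂ := h₂.1.1
  by_cases hc : ∃ p ∈ A, ∃ k ≤ K, ∃ l ≤ K, s₁^[k] c = s₁^[l] (a p)
  · obtain ⟨p, hp, k, hk, l, hl, hc⟩ := hc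
    obtain ⟨d, hd⟩ := h₂.1.2.iterate k (s₂^[l] (b p))
    have hc' : ∀ m, s₁^[k] (s₁^[m] c) = s₁^[m + l] (a p) := fun m => by
      rw [← Function.iterate_add_apply, add_comm k m, Function.iterate_add_apply, hc,
        ← Function.iterate_add_apply]
    have hd' : ∀ m, s₂^[k] (s₂^[m] d) = s₂^[m + l] (b p) := fun m => by
      rw [← Function.iterate_add_apply, add_comm k m, Function.iterate_add_apply, hd,
        ← Function.iterate_add_apply]
    refine ⟨d, ?_, ?_⟩
    · intro q hq m hm n hn
      rw [← (i₁.iterate k).eq_iff, ← (i₂.iterate k).eq_iff, hc', hd',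
        ← Function.iterate_add_apply, ← Function.iterate_add_apply]
      exact h p hp q hq _ (by omega) _ (by omega)
    · intro m hm n hn
      rw [← (i₁.iterate k).eq_iff, ← (i₂.iterate k).eq_iff, hc', hd', hc', hd']
      exact h p hp p hp _ (by omega) _ (by omega)
  · push Not at hc
    have key : ∃ n : ℕ, ∀ e ≤ K, (Function.minimalPeriod s₁ c ∣ e ↔ n + 1 ∣ e) := by
      by_cases hP : 1 ≤ Function.minimalPeriod s₁ c ∧ Function.minimalPeriod s₁ c ≤ K
      · refine ⟨Function.minimalPeriod s₁ c - 1, fun e _ => ?_⟩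
        rw [Nat.sub_add_cancel hP.1]
      · refine ⟨K, fun e he => ?_⟩
        rcases Nat.eq_zero_or_pos e with rfl | hpos
        · simp
        · constructor
          · intro hd
            have := Nat.le_of_dvd hpos hd
            have := Nat.pos_of_dvd_of_pos hd hpos
            omega
          · intro hd
            have := Nat.le_of_dvd hpos hd
            omega
    obtain ⟨n, hn⟩ := key
    have hfin : (⋃ p ∈ A, ⋃ k ∈ Finset.range (K + 1), ⋃ l ∈ Finset.range (K + 1),
        {x : N₂ | s₂^[k] x = s₂^[l] (b p)}).Finite := by
      refine Set.Finite.biUnion A.finite_toSet fun p _ => ?_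
      refine Set.Finite.biUnion (Finset.finite_toSet _) fun k _ => ?_
      refine Set.Finite.biUnion (Finset.finite_toSet _) fun l _ => ?_
      refine Set.Subsingleton.finite fun x hx y hy => i₂.iterate k ?_
      exact Eq.trans hx (Eq.symm hy)
    obtain ⟨d, hd, hd'⟩ := ((h₂.2 n).sdiff hfin).nonempty
    simp only [Set.mem_iUnion, Finset.mem_range, not_exists, Set.mem_ofPred_eq] at hd hd'
    refine ⟨d, ?_, ?_⟩
    · intro p hp k hk l hl
      exact iff_of_false (hc p hp k hk l hl) (hd' p hp k (by omega) l (by omega))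
    · intro k hk l hl
      rcases le_total k l with hkl | hkl
      · rw [iterate_eq_iff_dvd i₁ c hkl, iterate_eq_iff_dvd i₂ d hkl, hd]
        exact hn _ (by omega)
      · rw [eq_comm, iterate_eq_iff_dvd i₁ c hkl, eq_comm, iterate_eq_iff_dvd i₂ d hkl, hd]
        exact hn _ (by omega)

/-- Abbreviation for the language. -/
abbrev LS : Language.{0, 0} := LPlus Language.empty

theorem term_eq_iterate {β : Type*} (t : LS.Term β) : ∃ (x : β) (k : ℕ),
    ∀ (N : Type w) [LS.Structure N] (v : β → N),
      t.realize v = (sigmaMap Language.empty N)^[k] (v x) := by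
  induction t with
  | var x => exact ⟨x, 0, fun N _ v => rfl⟩
  | func f ts ih =>
    rcases f with f | f
    · exact isEmptyElim f
    · cases f
      obtain ⟨x, k, h⟩ := ih 0
      refine ⟨x, k + 1, fun N _ v => ?_⟩
      rw [Function.iterate_succ_apply', ← h N v]
      simp only [Term.realize, sigmaMap, sigmaSymb]
      congr 1
      ext i
      rw [Subsingleton.elim i 0]
      rfl

theorem Agree.snoc {α : Type*} {n : ℕ} {N₁ : Type*} {N₂ : Type*} {s₁ : N₁ → N₁} {s₂ : N₂ → N₂}
    (h₁ : GoodMap s₁) (h₂ : GoodMap s₂)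
    {A : Finset (α ⊕ Fin (n + 1))} {K : ℕ} {v₁ : α → N₁} {x₁ : Fin n → N₁}
    {v₂ : α → N₂} {x₂ : Fin n → N₂}
    (h : Agree s₁ s₂ (A.preimage (Sum.map id Fin.castSucc)
      ((Function.injective_id.sumMap (Fin.castSucc_injective n)).injOn)) (2 * K)
      (Sum.elim v₁ x₁) (Sum.elim v₂ x₂)) (c : N₁) :
    ∃ d : N₂, Agree s₁ s₂ A K (Sum.elim v₁ (Fin.snoc x₁ c : Fin (n + 1) → N₁))
      (Sum.elim v₂ (Fin.snoc x₂ d : Fin (n + 1) → N₂)) := by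
  obtain ⟨d, hd, hd'⟩ := h.extend h₁ h₂ c
  refine ⟨d, ?_⟩
  have splitCases : ∀ p : α ⊕ Fin (n + 1), p = Sum.inr (Fin.last n) ∨
      ∃ q : α ⊕ Fin n, p = Sum.map id Fin.castSucc q := by
    rintro (p | p)
    · exact Or.inr ⟨Sum.inl p, rfl⟩
    · refine Fin.lastCases (Or.inl rfl) (fun i => Or.inr ⟨Sum.inr i, rfl⟩) p
  have e₁ : ∀ q : α ⊕ Fin n, Sum.elim v₁ (Fin.snoc x₁ c : Fin (n + 1) → N₁)
      (Sum.map id Fin.castSucc q) = Sum.elim v₁ x₁ q := by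
    rintro (q | q) <;> simp
  have e₂ : ∀ q : α ⊕ Fin n, Sum.elim v₂ (Fin.snoc x₂ d : Fin (n + 1) → N₂)
      (Sum.map id Fin.castSucc q) = Sum.elim v₂ x₂ q := by
    rintro (q | q) <;> simp
  intro p hp q hq k hk l hl
  rcases splitCases p with rfl | ⟨p, rfl⟩ <;> rcases splitCases q with rfl | ⟨q, rfl⟩
  · simpa using hd' k hk l hl
  · rw [e₁, e₂]
    simpa using hd q (by simpa using hq) k hk l hl
  · rw [e₁, e₂, eq_comm, @eq_comm N₂]
    simpa using hd p (by simpa using hp) l hl k hk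
  · rw [e₁, e₂, e₁, e₂]
    exact h p (by simpa using hp) q (by simpa using hq) k (by omega) l (by omega)

theorem formula_determined {α : Type*} {n : ℕ} (φ : LS.BoundedFormula α n) :
    ∃ (A : Finset (α ⊕ Fin n)) (K : ℕ), ∀ (N₁ N₂ : Type w) [LS.Structure N₁] [LS.Structure N₂],
      GoodMap (sigmaMap Language.empty N₁) → GoodMap (sigmaMap Language.empty N₂) →
      ∀ (v₁ : α → N₁) (x₁ : Fin n → N₁) (v₂ : α → N₂) (x₂ : Fin n → N₂),
        Agree (sigmaMap Language.empty N₁) (sigmaMap Language.empty N₂) A K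
          (Sum.elim v₁ x₁) (Sum.elim v₂ x₂) → (φ.Realize v₁ x₁ ↔ φ.Realize v₂ x₂) := by
  classical
  induction φ with
  | falsum => exact ⟨∅, 0, fun _ _ _ _ _ _ _ _ _ _ _ => Iff.rfl⟩
  | equal t₁ t₂ =>
    obtain ⟨p, k, hp⟩ := term_eq_iterate.{w} t₁
    obtain ⟨q, l, hq⟩ := term_eq_iterate.{w} t₂
    refine ⟨{p, q}, max k l, fun N₁ N₂ _ _ _ _ v₁ x₁ v₂ x₂ h => ?_⟩
    simp only [BoundedFormula.Realize, hp, hq]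
    exact h p (by simp) q (by simp) k (by simp) l (by simp)
  | rel R ts =>
    rcases R with R | R
    · exact isEmptyElim R
    · exact Empty.elim R
  | imp φ ψ ih₁ ih₂ =>
    obtain ⟨A, K, h⟩ := ih₁
    obtain ⟨B, K', h'⟩ := ih₂
    refine ⟨A ∪ B, max K K', fun N₁ N₂ _ _ g₁ g₂ v₁ x₁ v₂ x₂ e => ?_⟩
    simp only [BoundedFormula.realize_imp]
    rw [h N₁ N₂ g₁ g₂ v₁ x₁ v₂ x₂ (e.mono Finset.subset_union_left (le_max_left _ _)),
      h' N₁ N₂ g₁ g₂ v₁ x₁ v₂ x₂ (e.mono Finset.subset_union_right (le_max_right _ _))]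
  | all φ ih =>
    obtain ⟨A, K, h⟩ := ih
    refine ⟨A.preimage (Sum.map id Fin.castSucc)
        ((Function.injective_id.sumMap (Fin.castSucc_injective _)).injOn), 2 * K,
      fun N₁ N₂ _ _ g₁ g₂ v₁ x₁ v₂ x₂ e => ?_⟩
    simp only [BoundedFormula.realize_all]
    constructor
    · intro H c
      obtain ⟨d, hd⟩ := e.symm.snoc g₂ g₁ c
      exact (h N₁ N₂ g₁ g₂ _ _ _ _ hd.symm).1 (H d)
    · intro H c
      obtain ⟨d, hd⟩ := e.snoc g₁ g₂ c
      exact (h N₁ N₂ g₁ g₂ _ _ _ _ hd).2 (H d)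

/-! ### The theory -/

/-- The term `σ^m t`. -/
def itTerm {α : Type*} (m : ℕ) (t : LS.Term α) : LS.Term α := sigmaTerm^[m] t

theorem realize_sigmaTerm {α : Type*} {N : Type*} [LS.Structure N] (t : LS.Term α) (v : α → N) :
    Term.realize v (sigmaTerm t) = sigmaMap Language.empty N (t.realize v) := by
  simp [sigmaTerm, sigmaMap]

theorem realize_itTerm {α : Type*} {N : Type*} [LS.Structure N] (m : ℕ) (t : LS.Term α)
    (v : α → N) :
    (itTerm m t).realize v = (sigmaMap Language.empty N)^[m] (t.realize v) := by
  induction m with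
  | zero => rfl
  | succ m ih =>
    rw [Function.iterate_succ_apply', ← ih, ← realize_sigmaTerm, itTerm, itTerm,
      Function.iterate_succ_apply']

/-- Outside of any `k` elements there is an element of exact period `n + 1`. -/
noncomputable def cycSentence (n k : ℕ) : LS.Sentence :=
  BoundedFormula.alls (n := k) (∃'
    ((itTerm (n + 1) (Term.var (Sum.inr (Fin.last k))) =' Term.var (Sum.inr (Fin.last k))) ⊓
     (BoundedFormula.iInf (fun i : Fin n =>
        ∼(itTerm (i + 1) (Term.var (Sum.inr (Fin.last k))) =' Term.var (Sum.inr (Fin.last k)))) ⊓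
      BoundedFormula.iInf (fun i : Fin k =>
        ∼(Term.var (Sum.inr (Fin.last k)) =' Term.var (Sum.inr (Fin.castSucc i)))))))

theorem minimalPeriod_eq_succ_iff {N : Type*} (s : N → N) (x : N) (n : ℕ) :
    Function.minimalPeriod s x = n + 1 ↔
      s^[n + 1] x = x ∧ ∀ i : Fin n, ¬ s^[(i : ℕ) + 1] x = x := by
  constructor
  · intro h
    refine ⟨?_, fun i hi => ?_⟩
    · rw [← h]; exact Function.isPeriodicPt_minimalPeriod s x
    · have : Function.IsPeriodicPt s (i + 1) x := hi
      have := this.minimalPeriod_le (Nat.succ_pos _)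
      omega
  · rintro ⟨h, h'⟩
    have hp : Function.IsPeriodicPt s (n + 1) x := h
    have hle := hp.minimalPeriod_le (Nat.succ_pos _)
    have hpos := hp.minimalPeriod_pos (Nat.succ_pos _)
    by_contra hne
    refine h' ⟨Function.minimalPeriod s x - 1, by omega⟩ ?_
    simp only
    rw [Nat.sub_add_cancel hpos]
    exact Function.isPeriodicPt_minimalPeriod s x

theorem realize_cycSentence {N : Type*} [LS.Structure N] (n k : ℕ) :
    N ⊨ cycSentence n k ↔ ∀ xs : Fin k → N, ∃ y,
      Function.minimalPeriod (sigmaMap Language.empty N) y = n + 1 ∧ ∀ i, y ≠ xs i := by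
  rw [cycSentence, Sentence.Realize, BoundedFormula.realize_alls]
  simp only [BoundedFormula.realize_ex, BoundedFormula.realize_inf, BoundedFormula.realize_iInf,
    BoundedFormula.realize_not, BoundedFormula.realize_bdEqual, realize_itTerm,
    minimalPeriod_eq_succ_iff, Term.realize_var, Sum.elim_inr, Fin.snoc_last, Fin.snoc_castSucc,
    and_assoc, ne_eq]

/-- The model completion. -/
noncomputable def Tmc : LS.Theory :=
  Taut Language.empty.infiniteTheory ∪ {φ | ∃ n k, φ = cycSentence n k}

theorem realize_sigmaInj {N : Type*} [LS.Structure N] :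
    N ⊨ sigmaInj Language.empty ↔ Function.Injective (sigmaMap Language.empty N) := by
  simp [sigmaInj, Sentence.Realize, Formula.Realize, realize_sigmaTerm, Function.Injective,
    Fin.snoc]

theorem realize_sigmaSurj {N : Type*} [LS.Structure N] :
    N ⊨ sigmaSurj Language.empty ↔ Function.Surjective (sigmaMap Language.empty N) := by
  simp [sigmaSurj, Sentence.Realize, Formula.Realize, realize_sigmaTerm, Function.Surjective,
    Fin.snoc]

theorem bijective_of_Taut {N : Type*} [LS.Structure N]
    (h : N ⊨ Taut Language.empty.infiniteTheory) :
    Function.Bijective (sigmaMap Language.empty N) :=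
  ⟨realize_sigmaInj.1 (h.realize_of_mem _ (by simp [Taut])),
   realize_sigmaSurj.1 (h.realize_of_mem _ (by simp [Taut]))⟩

theorem goodMap_of_Tmc {N : Type*} [LS.Structure N] (h : N ⊨ Tmc) :
    GoodMap (sigmaMap Language.empty N) := by
  refine ⟨bijective_of_Taut (h.mono Set.subset_union_left), fun n hfin => ?_⟩
  have hc : N ⊨ cycSentence n hfin.toFinset.card :=
    h.realize_of_mem _ (Or.inr ⟨_, _, rfl⟩)
  rw [realize_cycSentence] at hc
  obtain ⟨y, hy, hy'⟩ := hc (fun i => (hfin.toFinset.equivFin.symm i : N))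
  refine hy' (hfin.toFinset.equivFin ⟨y, by simpa using hy⟩) ?_
  simp

theorem Tmc_of_goodMap {N : Type*} [LS.Structure N] (h : GoodMap (sigmaMap Language.empty N)) :
    N ⊨ Tmc := by
  refine ⟨fun φ hφ => ?_⟩
  rcases hφ with (((hφ | hφ) | hφ) | hφ) | hφ
  · let _ : Language.empty.Structure N := (LHom.sumInl : Language.empty →ᴸ LS).reduct N
    have : Infinite N := ((h.2 0).to_subtype).of_injective _ Subtype.val_injective
    have h1 : N ⊨ Language.empty.infiniteTheory :=
      (model_infiniteTheory_iff Language.empty).2 inferInstance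
    have h2 : N ⊨ (LHom.sumInl : Language.empty →ᴸ LS).onTheory Language.empty.infiniteTheory :=
      (LHom.onTheory_model _ _).2 h1
    exact h2.realize_of_mem _ hφ
  · rcases hφ with rfl | rfl
    · exact realize_sigmaInj.2 h.1.1
    · exact realize_sigmaSurj.2 h.1.2
  · obtain ⟨n, F, -⟩ := hφ
    exact isEmptyElim F
  · obtain ⟨n, R, -⟩ := hφ
    exact isEmptyElim R
  · obtain ⟨n, k, rfl⟩ := hφ
    rw [realize_cycSentence]
    intro xs
    obtain ⟨y, hy, hy'⟩ := ((h.2 n).sdiff (Set.finite_range xs)).nonempty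
    exact ⟨y, hy, fun i hi => hy' ⟨i, hi.symm⟩⟩

/-! ### Stability -/

theorem swap_of_eq {N : Type*} (U : Ultrafilter ℕ) (f g : ℕ → N)
    (h : ∀ᶠ i in U, ∀ᶠ j in U, f i = g j) : ∀ᶠ j in U, ∀ᶠ i in U, f i = g j := by
  obtain ⟨i₀, h₀⟩ := h.exists
  filter_upwards [h₀] with j hj
  filter_upwards [h] with i hi
  obtain ⟨j', h1, h2⟩ := (hi.and h₀).exists
  rw [h1, ← h2, hj]

theorem swap_iff {N : Type*} (U : Ultrafilter ℕ) {nx ny : ℕ} (s : N → N)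
    (a : ℕ → Fin nx → N) (b : ℕ → Fin ny → N) (p q : Fin nx ⊕ Fin ny) (k l : ℕ) :
    (∀ᶠ i in U, ∀ᶠ j in U, s^[k] (Sum.elim (a i) (b j) p) = s^[l] (Sum.elim (a i) (b j) q)) ↔
    (∀ᶠ j in U, ∀ᶠ i in U, s^[k] (Sum.elim (a i) (b j) p) = s^[l] (Sum.elim (a i) (b j) q)) := by
  rcases p with p | p <;> rcases q with q | q <;>
    simp only [Sum.elim_inl, Sum.elim_inr, Filter.eventually_const]
  · exact ⟨swap_of_eq U (fun i => s^[k] (a i p)) (fun j => s^[l] (b j q)),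
      fun h => by
        have := swap_of_eq U (fun j => s^[l] (b j q)) (fun i => s^[k] (a i p))
          (by simpa only [eq_comm] using h)
        simpa only [eq_comm] using this⟩
  · have e : ∀ i j, (s^[k] (b j p) = s^[l] (a i q)) ↔ (s^[l] (a i q) = s^[k] (b j p)) :=
      fun i j => eq_comm
    simp only [e]
    exact ⟨swap_of_eq U (fun i => s^[l] (a i q)) (fun j => s^[k] (b j p)),
      fun h => by
        have := swap_of_eq U (fun j => s^[k] (b j p)) (fun i => s^[l] (a i q))
          (by simpa only [eq_comm] using h)
        simpa only [eq_comm] using this⟩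

theorem stable_of_Tmc (T : LS.Theory) (hT : Tmc ⊆ T) : IsStableTheory.{0, 0, u} T := by
  rintro ⟨nx, ny, φ, N, a, b, hab⟩
  have hN : N ⊨ Tmc := N.is_model.mono hT
  have g := goodMap_of_Tmc hN
  obtain ⟨A, K, hA⟩ := formula_determined.{u} φ
  let U : Ultrafilter ℕ := Filter.hyperfilter ℕ
  have hU : ∀ m : ℕ, ∀ᶠ i in U, m < i := fun m =>
    (Nat.cofinite_eq_atTop ▸ Filter.hyperfilter_le_cofinite (α := ℕ)) (Filter.eventually_gt_atTop m)
  let s := sigmaMap Language.empty N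
  let I := (Fin nx ⊕ Fin ny) × (Fin nx ⊕ Fin ny) × Fin (K + 1) × Fin (K + 1)
  let R : I → ℕ → ℕ → Prop := fun t i j =>
    s^[t.2.2.1] (Sum.elim (a i) (b j) t.1) = s^[t.2.2.2] (Sum.elim (a i) (b j) t.2.1)
  let c : I → Prop := fun t => ∀ᶠ i in U, ∀ᶠ j in U, R t i j
  have h1 : ∀ᶠ i in U, ∀ᶠ j in U, ∀ t, R t i j ↔ c t := by
    simp only [Filter.eventually_all]
    intro t
    by_cases hc : c t
    · simp only [hc, iff_true]
      exact hc
    · simp only [hc, iff_false]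
      simpa only [c, ← Ultrafilter.eventually_not] using hc
  have h2 : ∀ᶠ j in U, ∀ᶠ i in U, ∀ t, R t i j ↔ c t := by
    simp only [Filter.eventually_all]
    intro t
    have hsw : c t ↔ ∀ᶠ j in U, ∀ᶠ i in U, R t i j := swap_iff U s a b _ _ _ _
    by_cases hc : c t
    · simpa only [hc, iff_true] using hsw.1 hc
    · simp only [hc, iff_false]
      rw [hsw] at hc
      simpa only [← Ultrafilter.eventually_not] using hc
  obtain ⟨i, hi⟩ := h1.exists
  obtain ⟨j, hj, hij⟩ := (hi.and (hU i)).exists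
  obtain ⟨j', hj'⟩ := h2.exists
  obtain ⟨i', hi', hij'⟩ := (hj'.and (hU j')).exists
  have key := hA N N g g (Sum.elim (a i) (b j)) default (Sum.elim (a i') (b j')) default (by
    rintro (p | p) _ (q | q) _ k hk l hl
    · have e : R (p, q, ⟨k, by omega⟩, ⟨l, by omega⟩) i j ↔
        R (p, q, ⟨k, by omega⟩, ⟨l, by omega⟩) i' j' := (hj _).trans (hi' _).symm
      exact e
    · exact q.elim0
    · exact p.elim0
    · exact p.elim0)
  have k1 : φ.Realize (Sum.elim (a i) (b j)) := (hab i j).2 hij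
  have k2 : φ.Realize (Sum.elim (a i') (b j')) := key.1 k1
  have := (hab i' j').1 k2
  omega

/-! ### Extensions to models of `Tmc` -/

/-- The disjoint union of infinitely many cycles of every finite length. -/
abbrev Cyc : Type u := ULift.{u} (Σ n : ℕ, ℕ × ZMod (n + 1))

/-- The shift on `Cyc`. -/
def cycMap : Cyc.{u} → Cyc.{u} := fun x => ⟨⟨x.down.1, x.down.2.1, x.down.2.2 + 1⟩⟩

theorem cycMap_iterate (k : ℕ) (n m : ℕ) (z : ZMod (n + 1)) :
    cycMap.{u}^[k] ⟨⟨n, m, z⟩⟩ = ⟨⟨n, m, z + k⟩⟩ := by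
  induction k with
  | zero => simp
  | succ k ih =>
    rw [Function.iterate_succ_apply', ih]
    simp [cycMap, add_assoc]

theorem cycMap_minimalPeriod (n m : ℕ) (z : ZMod (n + 1)) :
    Function.minimalPeriod cycMap.{u} ⟨⟨n, m, z⟩⟩ = n + 1 := by
  refine Nat.dvd_right_iff_eq.1 fun k => ?_
  rw [← Function.isPeriodicPt_iff_minimalPeriod_dvd, Function.IsPeriodicPt, Function.IsFixedPt,
    cycMap_iterate, ← ZMod.natCast_eq_zero_iff]
  constructor
  · intro h
    have h' := congrArg ULift.down h
    simpa using h'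
  · intro h
    rw [h, add_zero]

theorem cycMap_bijective : Function.Bijective cycMap.{u} := by
  constructor
  · rintro ⟨⟨n, m, z⟩⟩ ⟨⟨n', m', z'⟩⟩ h
    have h' := congrArg ULift.down h
    simp only [cycMap, Sigma.mk.injEq] at h'
    obtain ⟨rfl, h'⟩ := h'
    simp only [heq_eq_eq, Prod.mk.injEq, add_left_inj] at h'
    obtain ⟨rfl, rfl⟩ := h'
    rfl
  · rintro ⟨⟨n, m, z⟩⟩
    exact ⟨⟨⟨n, m, z - 1⟩⟩, by simp [cycMap]⟩

/-- The `LS`-structure given by a self-map. -/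
@[reducible]
def structOf {N : Type u} (s : N → N) : LS.Structure N where
  funMap {n} f xs := match n, f, xs with
    | _, Sum.inr SigmaFunc.sigma, xs => s (xs 0)
  RelMap {n} R _ := match n, R with
    | _, Sum.inr R => Empty.elim R

theorem sigmaMap_structOf {N : Type u} (s : N → N) :
    @sigmaMap _ N (structOf s) = s := rfl

theorem minimalPeriod_map_inr {M : Type u} (s : M → M) (x : Cyc.{u}) :
    Function.minimalPeriod (Sum.map s cycMap) (Sum.inr x) = Function.minimalPeriod cycMap x := by
  have h : ∀ k, (Sum.map s cycMap)^[k] (Sum.inr x) = Sum.inr (cycMap^[k] x) := by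
    intro k
    induction k with
    | zero => rfl
    | succ k ih => rw [Function.iterate_succ_apply', ih, Function.iterate_succ_apply']; rfl
  refine Nat.dvd_right_iff_eq.1 fun k => ?_
  rw [← Function.isPeriodicPt_iff_minimalPeriod_dvd, ← Function.isPeriodicPt_iff_minimalPeriod_dvd,
    Function.IsPeriodicPt, Function.IsFixedPt, h, Sum.inr.injEq]
  rfl

theorem goodMap_sum {M : Type u} (s : M → M) (hs : Function.Bijective s) :
    GoodMap (Sum.map s cycMap.{u}) := by
  refine ⟨⟨hs.1.sumMap cycMap_bijective.1, hs.2.sumMap cycMap_bijective.2⟩, fun n => ?_⟩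
  refine Set.infinite_of_injective_forall_mem (f := fun m : ℕ =>
    (Sum.inr ⟨⟨n, m, 0⟩⟩ : M ⊕ Cyc.{u})) ?_ ?_
  · intro m m' h
    have h' := congrArg ULift.down (Sum.inr.inj h)
    simpa using h'
  · intro m
    change Function.minimalPeriod _ _ = n + 1
    rw [minimalPeriod_map_inr, cycMap_minimalPeriod]

theorem exists_extension (M : Type u) [Nonempty M] [LS.Structure M]
    (hM : M ⊨ Taut Language.empty.infiniteTheory) :
    ∃ N : Theory.ModelType.{0, 0, u} Tmc, Nonempty (M ↪[LS] N) := by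
  let s := sigmaMap Language.empty M
  let inst : LS.Structure (M ⊕ Cyc.{u}) := structOf (Sum.map s cycMap)
  have hN : (M ⊕ Cyc.{u}) ⊨ Tmc := Tmc_of_goodMap (goodMap_sum s (bijective_of_Taut hM))
  refine ⟨Theory.ModelType.of Tmc (M ⊕ Cyc.{u}), ⟨⟨⟨Sum.inl, Sum.inl_injective⟩, ?_, ?_⟩⟩⟩
  · intro n f xs
    rcases f with f | f
    · exact isEmptyElim f
    · cases f
      change Sum.inl (funMap (sigmaSymb Language.empty) xs) = Sum.inl (s (xs 0))
      congr 1
      change _ = funMap (sigmaSymb Language.empty) _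
      congr 1
      ext i
      rw [Subsingleton.elim i 0]
      rfl
  · intro n R xs
    rcases R with R | R
    · exact isEmptyElim R
    · exact Empty.elim R

/-! ### Completeness over diagrams -/

theorem satisfiable_diagram (M : Type u) [Nonempty M] [LS.Structure M]
    (hM : M ⊨ Taut Language.empty.infiniteTheory) :
    ((LS.lhomWithConstants M).onTheory Tmc ∪ atomicDiagram LS M).IsSatisfiable := by
  obtain ⟨N, ⟨f⟩⟩ := exists_extension M hM
  let _ : (constantsOn M).Structure N := constantsOn.structure f
  let F : M ↪[LS[[M]]] N := by
    refine ⟨f.toEmbedding, ?_, ?_⟩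
    · intro n g x
      cases g with
      | inl g => exact f.map_fun' g x
      | inr g =>
        cases n with
        | zero => rfl
        | succ n => exact isEmptyElim g
    · intro n R x
      rcases R with (R | R) | R
      · exact isEmptyElim R
      · exact Empty.elim R
      · exact isEmptyElim R
  have hN : N ⊨ ((LS.lhomWithConstants M).onTheory Tmc ∪ atomicDiagram LS M) := by
    rw [Theory.model_union_iff]
    refine ⟨(LHom.onTheory_model _ _).2 N.is_model, ⟨fun φ hφ => ?_⟩⟩
    obtain ⟨h, hφM⟩ := hφ
    have hqf : φ.IsQF := by
      rcases h with h | ⟨ψ, h, rfl⟩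
      · exact h.isQF
      · exact h.isQF.not
    have := (hqf.realize_embedding F (v := default) (xs := default)).2 hφM
    have e1 : (F ∘ default : Empty → N) = default := Subsingleton.elim _ _
    have e2 : (F ∘ default : Fin 0 → N) = default := Subsingleton.elim _ _
    rw [e1, e2] at this
    exact this
  exact Theory.Model.isSatisfiable N

theorem diagram_iterate (M : Type u) [LS.Structure M] (N : Type u) [LS.Structure N]
    [LS[[M]].Structure N] [(LS.lhomWithConstants M).IsExpansionOn N]
    (hN : N ⊨ atomicDiagram LS M) (p q : M) (k l : ℕ) :
    (sigmaMap Language.empty N)^[k] (LS.con p : N) = (sigmaMap Language.empty N)^[l] (LS.con q : N) ↔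
    (sigmaMap Language.empty M)^[k] p = (sigmaMap Language.empty M)^[l] q := by
  let χ : LS.Formula M := Term.equal (itTerm k (Term.var p)) (itTerm l (Term.var q))
  let ψ : LS[[M]].Sentence := Formula.equivSentence χ
  have hψ : ψ.IsAtomic := BoundedFormula.IsAtomic.equal _ _
  have h1 : N ⊨ ψ ↔ M ⊨ ψ := by
    by_cases h : M ⊨ ψ
    · exact iff_of_true (hN.realize_of_mem _ ⟨Or.inl hψ, h⟩) h
    · refine iff_of_false ?_ h
      have : N ⊨ ∼ψ := hN.realize_of_mem _ ⟨Or.inr ⟨ψ, hψ, rfl⟩, (Sentence.realize_not M).2 h⟩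
      exact (Sentence.realize_not N).1 this
  rw [Formula.realize_equivSentence, Formula.realize_equivSentence] at h1
  simp only [χ, Formula.realize_equal, realize_itTerm, Term.realize_var] at h1
  exact h1

theorem complete_diagram (M : Type u) [LS.Structure M] (φ : LS[[M]].Sentence)
    (N₁ N₂ : Type u) [i₁ : LS[[M]].Structure N₁] [i₂ : LS[[M]].Structure N₂]
    (h₁ : N₁ ⊨ (LS.lhomWithConstants M).onTheory Tmc ∪ atomicDiagram LS M)
    (h₂ : N₂ ⊨ (LS.lhomWithConstants M).onTheory Tmc ∪ atomicDiagram LS M) :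
    N₁ ⊨ φ → N₂ ⊨ φ := by
  let _ : LS.Structure N₁ := (LS.lhomWithConstants M).reduct N₁
  let _ : LS.Structure N₂ := (LS.lhomWithConstants M).reduct N₂
  rw [Theory.model_union_iff, LHom.onTheory_model] at h₁ h₂
  obtain ⟨A, K, hA⟩ := formula_determined.{u} (Formula.equivSentence.symm φ)
  rw [← Formula.realize_equivSentence_symm_con N₁ φ, ← Formula.realize_equivSentence_symm_con N₂ φ]
  refine (hA N₁ N₂ (goodMap_of_Tmc h₁.1) (goodMap_of_Tmc h₂.1) _ _ _ _ ?_).1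
  rintro (p | p) _ (q | q) _ k hk l hl
  · exact (diagram_iterate M N₁ h₁.2 p q k l).trans (diagram_iterate M N₂ h₂.2 p q k l).symm
  · exact q.elim0
  · exact p.elim0
  · exact p.elim0

theorem infiniteTheory_aut_modelCompletion_stable :
    ∃ Tmc : (LPlus Language.empty).Theory,
      IsModelCompletion.{0, 0, u} (Taut Language.empty.infiniteTheory) Tmc ∧
      ∀ Tstar : (LPlus Language.empty).Theory, IsCompletionOf Tmc Tstar →
        IsStableTheory.{0, 0, u} Tstar := by
  refine ⟨Tmc, ⟨Set.subset_union_left, fun M => exists_extension M M.is_model, fun M => ?_⟩,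
    fun T hT => stable_of_Tmc T hT.1⟩
  refine ⟨satisfiable_diagram M M.is_model, fun φ => ?_⟩
  obtain ⟨N₀⟩ := satisfiable_diagram M M.is_model
  by_cases h : N₀ ⊨ φ
  · left
    rw [Theory.models_sentence_iff]
    intro N
    exact complete_diagram M φ N₀ N N₀.is_model N.is_model h
  · right
    rw [Theory.models_sentence_iff]
    intro N
    rw [Sentence.realize_not]
    intro hN
    exact h (complete_diagram M φ N N₀ N.is_model N₀.is_model hN)

end ShelahE34

end FirstOrder
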